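/- arXiv:2010.04793 — 2 statements merged into one kernel-verified Lean document; each statement's English description precedes it below -/
import Mathlib

section
/- Let d ≥ 2, j ∈ ℤ_+, and a > 0. Writing χ_j = 1 if j is odd and χ_j = 0 if j is even, one has A(S^{d−2}) ∫_{−1}^1 |t|^a (sgn t)^{χ_j} C̃_j^{(d−2)/2}(t) (1−t²)^{(d−3)/2} dt = π^{d/2} Γ(a+1) / (2^{a−1} Γ((j+a+d)/2) Γ((a−j)/2 + 1)), where A(S^{d−2}) = 2π^{(d−1)/2}/Γ((d−1)/2). -/
open MeasureTheory Real Filter Topology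
open scoped RealInnerProductSpace ENNReal NNReal

noncomputable section

namespace StablePaper

abbrev Ed (d : ℕ) : Type := EuclideanSpace ℝ (Fin d)

abbrev Sph (d : ℕ) := Metric.sphere (0 : Ed d) 1

/-- The surface measure `ω` on the unit sphere `S^{d-1}`. -/
def ωd (d : ℕ) : Measure (Sph d) := (volume : Measure (Ed d)).toSphere

/-- `u_z = z/|z|` for `z ≠ 0`, as a point of the unit sphere. -/
def unitize {d : ℕ} (z : Ed d) (hz : z ≠ 0) : Sph d :=
  ⟨‖z‖⁻¹ • z, by
    rw [mem_sphere_iff_norm, sub_zero, norm_smul, norm_inv, norm_norm,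
      inv_mul_cancel₀ (norm_ne_zero_iff.mpr hz)]⟩

/-- Negation on the unit sphere. -/
def negS {d : ℕ} (u : Sph d) : Sph d :=
  ⟨-(u : Ed d), by
    rw [mem_sphere_iff_norm, sub_zero, norm_neg]
    have := u.2
    rwa [mem_sphere_iff_norm, sub_zero] at this⟩

/-- Rising factorial (Pochhammer symbol) `(b)_n`. -/
def risingFactorial (b : ℝ) (n : ℕ) : ℝ := ∏ i ∈ Finset.range n, (b + i)

/-- The Gegenbauer polynomial `C_j^b(t)` (for `b > 0`), via its explicit sum formula. -/
def gegenbauer (b : ℝ) (j : ℕ) (t : ℝ) : ℝ :=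
  ∑ m ∈ Finset.range (j / 2 + 1),
    (-1 : ℝ) ^ m * 2 ^ (j - 2 * m) * risingFactorial b (j - m) /
      ((Nat.factorial m : ℝ) * (Nat.factorial (j - 2 * m) : ℝ)) * t ^ (j - 2 * m)

/-- The normalized (ultraspherical) polynomial `C̃_j^b(t) = C_j^b(t)/C_j^b(1)`;
for `b = 0` it is the Chebyshev polynomial `T_j`. -/
def gegenbauerN (b : ℝ) (j : ℕ) (t : ℝ) : ℝ :=
  if b = 0 then (Polynomial.Chebyshev.T ℝ (j : ℤ)).eval t
  else gegenbauer b j t / gegenbauer b j 1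

/-- `c_{j,d} = dim ℋ_{j,d}`. -/
def cdim (d j : ℕ) : ℕ :=
  if j = 0 then 1 else Nat.choose (j + d - 2) j + Nat.choose (j + d - 3) (j - 1)

/-- The surface area `A(S^{d-1}) = 2 π^{d/2} / Γ(d/2)`. -/
def sphereArea (d : ℕ) : ℝ := 2 * Real.pi ^ ((d : ℝ) / 2) / Real.Gamma ((d : ℝ) / 2)

/-- Projection onto spherical harmonics of degree `j` (real-valued version):
`(proj_j f)(u) = (c_{j,d}/A(S^{d-1})) ∫ C̃_j^{(d-2)/2}(⟨u,v⟩) f(v) ω(dv)`. -/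
def projR (d j : ℕ) (f : Sph d → ℝ) (u : Sph d) : ℝ :=
  (cdim d j : ℝ) / sphereArea d *
    ∫ v, gegenbauerN (((d : ℝ) - 2) / 2) j ⟪(u : Ed d), (v : Ed d)⟫ * f v ∂(ωd d)

/-- Projection onto spherical harmonics of degree `j` (complex-valued version). -/
def projC (d j : ℕ) (f : Sph d → ℂ) (u : Sph d) : ℂ :=
  ((cdim d j : ℂ) / (sphereArea d : ℂ)) *
    ∫ v, (gegenbauerN (((d : ℝ) - 2) / 2) j ⟪(u : Ed d), (v : Ed d)⟫ : ℂ) * f v ∂(ωd d)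

/-- The coefficients `w_j(α)`. -/
def w (d : ℕ) (α : ℝ) (j : ℕ) : ℝ :=
  Real.pi ^ ((d : ℝ) / 2) * Real.Gamma (α + 1) /
    (2 ^ (α - 1) * Real.Gamma (((j : ℝ) + α + d) / 2) * Real.Gamma ((α - j) / 2 + 1))

/-- The characteristic exponent of an `α`-stable distribution (`α ≠ 1`) with
spectral spherical measure `Λ`. -/
def charExp (d : ℕ) (α : ℝ) (Λ : Measure (Sph d)) (z : Ed d) : ℂ :=
  ∫ v, (|⟪z, (v : Ed d)⟫| ^ α : ℝ) *
      (1 - Complex.I * (Real.tan (Real.pi * α / 2) : ℂ) *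
        (Real.sign ⟪z, (v : Ed d)⟫ : ℂ)) ∂Λ

/-- `V(u)`, so that `Φ_μ(z) = |z|^α V(u_z)`. -/
def Vfun (d : ℕ) (α : ℝ) (Λ : Measure (Sph d)) (u : Sph d) : ℂ :=
  charExp d α Λ (u : Ed d)

/-- The characteristic exponent of a `1`-stable distribution with
spectral spherical measure `Λ`. -/
def charExp1 (d : ℕ) (Λ : Measure (Sph d)) (z : Ed d) : ℂ :=
  ∫ v, ((|⟪z, (v : Ed d)⟫| : ℝ) : ℂ) +
      Complex.I * ((2 / Real.pi * (⟪z, (v : Ed d)⟫ *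
        Real.log |⟪z, (v : Ed d)⟫|) : ℝ) : ℂ) ∂Λ

/-- The spectral spherical measure `λ(dv) = P(v) ω(dv)`. -/
def specMeasure (d : ℕ) (P : Sph d → ℝ) : Measure (Sph d) :=
  (ωd d).withDensity (fun v => ENNReal.ofReal (P v))

/-- `μ` has Fourier transform `exp (-Φ)` where `Φ` is the `α`-stable characteristic
exponent with spectral spherical measure `Λ` (case `α ≠ 1`). -/
def IsStableChar (d : ℕ) (α : ℝ) (Λ : Measure (Sph d)) (μ : Measure (Ed d)) : Prop :=
  ∀ z : Ed d, ∫ x, Complex.exp (Complex.I * (⟪z, x⟫ : ℂ)) ∂μ =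
    Complex.exp (- charExp d α Λ z)

/-- `μ` has Fourier transform `exp (-Φ)` where `Φ` is the `1`-stable characteristic
exponent with spectral spherical measure `Λ`. -/
def IsStableChar1 (d : ℕ) (Λ : Measure (Sph d)) (μ : Measure (Ed d)) : Prop :=
  ∀ z : Ed d, ∫ x, Complex.exp (Complex.I * (⟪z, x⟫ : ℂ)) ∂μ =
    Complex.exp (- charExp1 d Λ z)

/-- `μ` is nondegenerate: its support is not contained in any proper affine subspace. -/
def Nondegenerate (d : ℕ) (μ : Measure (Ed d)) : Prop :=
  ∀ (a : Ed d) (W : Submodule ℝ (Ed d)), W ≠ ⊤ →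
    μ ((fun x => a + x) '' (W : Set (Ed d))) < 1

/-- `P` is the restriction to the sphere of a polynomial on `ℝ^d`. -/
def IsPolyRestriction (d : ℕ) (P : Sph d → ℝ) : Prop :=
  ∃ p : MvPolynomial (Fin d) ℝ,
    ∀ u : Sph d, P u = MvPolynomial.eval (fun i => (u : Ed d) i) p

/-- `P` is the restriction to the sphere of a polynomial of degree at most `q`. -/
def IsPolyRestrictionDeg (d q : ℕ) (P : Sph d → ℝ) : Prop :=
  ∃ p : MvPolynomial (Fin d) ℝ, p.totalDegree ≤ q ∧
    ∀ u : Sph d, P u = MvPolynomial.eval (fun i => (u : Ed d) i) p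

/-- `f` is a spherical harmonic of degree `j`: the restriction to the sphere of a
homogeneous harmonic polynomial of degree `j`. -/
def IsSphericalHarmonicC (d j : ℕ) (f : Sph d → ℂ) : Prop :=
  ∃ p : MvPolynomial (Fin d) ℂ, p.IsHomogeneous j ∧
    (∑ i : Fin d, MvPolynomial.pderiv i (MvPolynomial.pderiv i p)) = 0 ∧
    ∀ u : Sph d, f u = MvPolynomial.eval (fun i => ((u : Ed d) i : ℂ)) p

/-- `S_{j,k} = (-i)^j proj_j (V^k)`. -/
def SHk (d : ℕ) (α : ℝ) (Λ : Measure (Sph d)) (j k : ℕ) (u : Sph d) : ℂ :=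
  (-Complex.I) ^ j * projC d j (fun v => (Vfun d α Λ v) ^ k) u

/-- `S_{j,p} = (-i)^j proj_j (V^p)` for real exponents `p` (principal branch). -/
def SHp (d : ℕ) (α : ℝ) (Λ : Measure (Sph d)) (j : ℕ) (p : ℝ) (u : Sph d) : ℂ :=
  (-Complex.I) ^ j * projC d j (fun v => (Vfun d α Λ v) ^ (p : ℂ)) u

/-- `g` is the density of the stable distribution with characteristic exponent
`charExp d α Λ`, given by the Fourier inversion formula. -/
def IsDensityOf (d : ℕ) (α : ℝ) (Λ : Measure (Sph d)) (g : Ed d → ℝ) : Prop :=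
  ∀ x : Ed d, (g x : ℂ) =
    (((2 * Real.pi) ^ d)⁻¹ : ℝ) *
      ∫ z : Ed d, Complex.exp (-(Complex.I * (⟪x, z⟫ : ℂ))) *
        Complex.exp (- charExp d α Λ z)

/-- Harmonic numbers `s_n`. -/
def harmonicNum (n : ℕ) : ℝ := ∑ i ∈ Finset.range n, (1 : ℝ) / (i + 1)

def betaD (d : ℕ) : ℝ :=
  if Even d then 1 - Real.log 2 - harmonicNum (d / 2) / 2
  else 1 - harmonicNum (d + 1) + harmonicNum ((d + 1) / 2) / 2

/-- The coefficients `w*_j` (for odd `j`). -/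
def wstar (d j : ℕ) : ℝ :=
  if j = 1 then Real.pi ^ ((d : ℝ) / 2) * betaD d / Real.Gamma ((d : ℝ) / 2 + 1)
  else (-1 : ℝ) ^ ((j - 3) / 2) * Real.pi ^ ((d : ℝ) / 2) *
      Real.Gamma (((j : ℝ) - 1) / 2) / (2 * Real.Gamma (((d : ℝ) + 1 + j) / 2))

/-- The Bessel function of the first kind `J_τ`. -/
def besselJ (τ : ℝ) (x : ℝ) : ℝ :=
  ∑' k : ℕ, (-1 : ℝ) ^ k * (x / 2) ^ (2 * (k : ℝ) + τ) /
    ((Nat.factorial k : ℝ) * Real.Gamma ((k : ℝ) + τ + 1))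

end StablePaper

namespace StablePaper

theorem risingFactorial_succ (b : ℝ) (n : ℕ) :
    risingFactorial b (n + 1) = risingFactorial b n * (b + n) := by
  simp [risingFactorial, Finset.prod_range_succ]

/-- The term of degree `k` in the Gegenbauer polynomial `C_{k+2m}^b`. -/
def gegenbauerTerm (b t : ℝ) (m k : ℕ) : ℝ :=
  (-1 : ℝ) ^ m * 2 ^ k * risingFactorial b (m + k) /
    ((Nat.factorial m : ℝ) * (Nat.factorial k : ℝ)) * t ^ k

theorem gegenbauer_eq_sum_term (b : ℝ) (j : ℕ) (t : ℝ) :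
    gegenbauer b j t =
      ∑ m ∈ Finset.range (j / 2 + 1), gegenbauerTerm b t m (j - 2 * m) := by
  refine Finset.sum_congr rfl fun m hm => ?_
  have : m + (j - 2 * m) = j - m := by
    have := Finset.mem_range.1 hm
    omega
  rw [gegenbauerTerm, this]

theorem gegenbauerTerm_zero_succ (b t : ℝ) (k : ℕ) :
    ((k : ℝ) + 1) * gegenbauerTerm b t 0 (k + 1) =
      2 * (k + b) * t * gegenbauerTerm b t 0 k := by
  have hk : ((Nat.factorial k : ℕ) : ℝ) ≠ 0 := by positivity
  have hk1 : (k : ℝ) + 1 ≠ 0 := by positivity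
  simp only [gegenbauerTerm, zero_add, risingFactorial_succ, Nat.factorial_succ, Nat.cast_mul,
    Nat.cast_succ, Nat.factorial_zero]
  field_simp
  ring

theorem gegenbauerTerm_succ_zero (b t : ℝ) (m : ℕ) :
    (2 * (m : ℝ) + 2) * gegenbauerTerm b t (m + 1) 0 =
      -((2 * m + 2 * b) * gegenbauerTerm b t m 0) := by
  have hm : ((Nat.factorial m : ℕ) : ℝ) ≠ 0 := by positivity
  have hm1 : (m : ℝ) + 1 ≠ 0 := by positivity
  simp only [gegenbauerTerm, add_zero, risingFactorial_succ, Nat.factorial_succ, Nat.cast_mul,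
    Nat.cast_succ, Nat.factorial_zero]
  field_simp
  ring

theorem gegenbauerTerm_succ_succ (b t : ℝ) (m k : ℕ) :
    (2 * (m : ℝ) + k + 3) * gegenbauerTerm b t (m + 1) (k + 1) =
      2 * (2 * m + k + 2 + b) * t * gegenbauerTerm b t (m + 1) k -
        (2 * m + k + 1 + 2 * b) * gegenbauerTerm b t m (k + 1) := by
  have hm : ((Nat.factorial m : ℕ) : ℝ) ≠ 0 := by positivity
  have hm1 : (m : ℝ) + 1 ≠ 0 := by positivity
  have hk : ((Nat.factorial k : ℕ) : ℝ) ≠ 0 := by positivity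
  have hk1 : (k : ℝ) + 1 ≠ 0 := by positivity
  have e1 : m + 1 + (k + 1) = (m + k) + 1 + 1 := by ring
  have e2 : m + 1 + k = (m + k) + 1 := by ring
  have e3 : m + (k + 1) = (m + k) + 1 := by ring
  simp only [gegenbauerTerm, e1, e2, e3, risingFactorial_succ, Nat.factorial_succ, Nat.cast_mul,
    Nat.cast_succ, Nat.cast_add]
  field_simp
  ring

theorem gegenbauer_recurrence (b t : ℝ) (j : ℕ) :
    ((j : ℝ) + 2) * gegenbauer b (j + 2) t =
      2 * (j + 1 + b) * t * gegenbauer b (j + 1) t - (j + 2 * b) * gegenbauer b j t := by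
  simp only [gegenbauer_eq_sum_term]
  have hj : (j + 2) / 2 + 1 = (j / 2 + 1) + 1 := by omega
  have hz : ((j : ℝ) + 2) * gegenbauerTerm b t 0 (j + 1 + 1) =
      2 * (j + 1 + b) * t * gegenbauerTerm b t 0 (j + 1) := by
    have := gegenbauerTerm_zero_succ b t (j + 1)
    push_cast at this
    linear_combination this
  rw [hj, Finset.sum_range_succ']
  have hstep : ∀ m k : ℕ, j = 2 * m + k + 1 →
      ((j : ℝ) + 2) * gegenbauerTerm b t (m + 1) (k + 1) =
        2 * (j + 1 + b) * t * gegenbauerTerm b t (m + 1) k -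
          (j + 2 * b) * gegenbauerTerm b t m (k + 1) := by
    rintro m k rfl
    have := gegenbauerTerm_succ_succ b t m k
    push_cast
    linear_combination this
  have hstep' : ∀ m : ℕ, 2 * m + 1 ≤ j →
      ((j : ℝ) + 2) * gegenbauerTerm b t (m + 1) (j + 2 - 2 * (m + 1)) =
        2 * (j + 1 + b) * t * gegenbauerTerm b t (m + 1) (j + 1 - 2 * (m + 1)) -
          (j + 2 * b) * gegenbauerTerm b t m (j - 2 * m) := by
    intro m hm
    obtain ⟨k, hk⟩ := Nat.exists_eq_add_of_le hm
    have := hstep m k (by omega)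
    rwa [show j + 2 - 2 * (m + 1) = k + 1 by omega, show j + 1 - 2 * (m + 1) = k by omega,
      show j - 2 * m = k + 1 by omega]
  rcases Nat.even_or_odd' j with ⟨n, hn | hn⟩
  · have h1 : (j + 1) / 2 + 1 = n + 1 := by omega
    have h2 : j / 2 + 1 = n + 1 := by omega
    rw [h1, h2, Finset.sum_range_succ' (fun m => gegenbauerTerm b t m (j + 1 - 2 * m)) n,
      Finset.sum_range_succ (fun m => gegenbauerTerm b t m (j - 2 * m)) n,
      Finset.sum_range_succ
        (fun m => gegenbauerTerm b t (m + 1) (j + 2 - 2 * (m + 1))) n]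
    have hlast : ((j : ℝ) + 2) * gegenbauerTerm b t (n + 1) (j + 2 - 2 * (n + 1)) =
        -((j + 2 * b) * gegenbauerTerm b t n (j - 2 * n)) := by
      rw [show j + 2 - 2 * (n + 1) = 0 by omega, show j - 2 * n = 0 by omega, hn]
      have := gegenbauerTerm_succ_zero b t n
      push_cast
      linear_combination this
    have hsum : ((j : ℝ) + 2) *
          ∑ m ∈ Finset.range n, gegenbauerTerm b t (m + 1) (j + 2 - 2 * (m + 1)) =
        2 * (j + 1 + b) * t *
            ∑ m ∈ Finset.range n, gegenbauerTerm b t (m + 1) (j + 1 - 2 * (m + 1)) -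
          (j + 2 * b) * ∑ m ∈ Finset.range n, gegenbauerTerm b t m (j - 2 * m) := by
      rw [Finset.mul_sum, Finset.mul_sum, Finset.mul_sum, ← Finset.sum_sub_distrib]
      exact Finset.sum_congr rfl fun m hm => hstep' m (by have := Finset.mem_range.1 hm; omega)
    simp only [mul_zero, Nat.sub_zero]
    linear_combination hsum + hlast + hz
  · have h1 : (j + 1) / 2 + 1 = n + 1 + 1 := by omega
    have h2 : j / 2 + 1 = n + 1 := by omega
    rw [h1, h2, Finset.sum_range_succ' _ (n + 1)]
    have hsum : ((j : ℝ) + 2) *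
          ∑ m ∈ Finset.range (n + 1), gegenbauerTerm b t (m + 1) (j + 2 - 2 * (m + 1)) =
        2 * (j + 1 + b) * t *
            ∑ m ∈ Finset.range (n + 1), gegenbauerTerm b t (m + 1) (j + 1 - 2 * (m + 1)) -
          (j + 2 * b) * ∑ m ∈ Finset.range (n + 1), gegenbauerTerm b t m (j - 2 * m) := by
      rw [Finset.mul_sum, Finset.mul_sum, Finset.mul_sum, ← Finset.sum_sub_distrib]
      exact Finset.sum_congr rfl fun m hm => hstep' m (by have := Finset.mem_range.1 hm; omega)
    simp only [mul_zero, Nat.sub_zero]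
    linear_combination hsum + hz

theorem gegenbauer_zero (b t : ℝ) : gegenbauer b 0 t = 1 := by
  simp [gegenbauer, risingFactorial]

theorem gegenbauer_one (b t : ℝ) : gegenbauer b 1 t = 2 * b * t := by
  simp [gegenbauer, risingFactorial]

theorem gegenbauer_succ_at_one (b : ℝ) (j : ℕ) :
    ((j : ℝ) + 1) * gegenbauer b (j + 1) 1 = (j + 2 * b) * gegenbauer b j 1 := by
  induction j with
  | zero => simp [gegenbauer_zero, gegenbauer_one]
  | succ j ih =>
    have := gegenbauer_recurrence b 1 j
    push_cast
    linear_combination this + ih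

theorem gegenbauer_at_one_pos {b : ℝ} (hb : 0 < b) (j : ℕ) : 0 < gegenbauer b j 1 := by
  induction j with
  | zero => simp [gegenbauer_zero]
  | succ j ih =>
    have h := gegenbauer_succ_at_one b j
    have : 0 < ((j : ℝ) + 1) * gegenbauer b (j + 1) 1 := by rw [h]; positivity
    exact pos_of_mul_pos_right this (by positivity)

theorem gegenbauerN_zero {b : ℝ} (t : ℝ) : gegenbauerN b 0 t = 1 := by
  by_cases h : b = 0 <;> simp [gegenbauerN, h, gegenbauer_zero]

theorem gegenbauerN_one {b : ℝ} (t : ℝ) : gegenbauerN b 1 t = t := by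
  by_cases h : b = 0
  · simp [gegenbauerN, h]
  · simp only [gegenbauerN, h, if_false, gegenbauer_one]
    field_simp

theorem gegenbauerN_recurrence {b : ℝ} (hb : 0 ≤ b) (t : ℝ) (j : ℕ) :
    ((j : ℝ) + 1 + 2 * b) * gegenbauerN b (j + 2) t =
      2 * (j + 1 + b) * t * gegenbauerN b (j + 1) t - (j + 1) * gegenbauerN b j t := by
  rcases hb.eq_or_lt with rfl | hb
  · have h := congrArg (Polynomial.eval t) (Polynomial.Chebyshev.T_add_two ℝ (j : ℤ))
    simp only [Polynomial.eval_sub, Polynomial.eval_mul, Polynomial.eval_X,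
      Polynomial.eval_ofNat] at h
    simp only [gegenbauerN, if_true]
    push_cast
    rw [h]
    ring
  · have g0 := gegenbauer_at_one_pos hb j
    have h1 := gegenbauer_succ_at_one b j
    have h2 := gegenbauer_succ_at_one b (j + 1)
    have hr := gegenbauer_recurrence b t j
    have e1 : gegenbauer b (j + 1) 1 = (j + 2 * b) / (j + 1) * gegenbauer b j 1 := by
      field_simp
      linear_combination h1
    have e2 : gegenbauer b (j + 2) 1 =
        (j + 1 + 2 * b) / (j + 2) * ((j + 2 * b) / (j + 1) * gegenbauer b j 1) := by
      rw [← e1]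
      push_cast at h2
      field_simp
      linear_combination h2
    have e3 : gegenbauer b (j + 2) t = (2 * (j + 1 + b) * t * gegenbauer b (j + 1) t -
        (j + 2 * b) * gegenbauer b j t) / (j + 2) := by
      field_simp
      linear_combination hr
    simp only [gegenbauerN, hb.ne', if_false]
    rw [e2, e1, e3]
    have : (j : ℝ) + 2 * b ≠ 0 := by positivity
    have : (j : ℝ) + 1 + 2 * b ≠ 0 := by positivity
    field_simp

theorem continuous_gegenbauerN (b : ℝ) (j : ℕ) : Continuous (gegenbauerN b j) := by
  unfold gegenbauerN
  split_ifs
  · exact Polynomial.continuous _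
  · unfold gegenbauer
    fun_prop

theorem integral_beta {p q : ℝ} (hp : 0 < p) (hq : 0 < q) :
    ∫ x in Set.Ioo (0 : ℝ) 1, x ^ (p - 1) * (1 - x) ^ (q - 1) = ProbabilityTheory.beta p q := by
  rw [ProbabilityTheory.beta_eq_betaIntegralReal p q hp hq, Complex.betaIntegral,
    intervalIntegral.integral_of_le zero_le_one, ← integral_Ioc_eq_integral_Ioo]
  rw [← Complex.ofReal_re (∫ x in Set.Ioc (0 : ℝ) 1, x ^ (p - 1) * (1 - x) ^ (q - 1)),
    ← integral_complex_ofReal]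
  congr 1
  refine setIntegral_congr_fun measurableSet_Ioc fun x hx => ?_
  have h1 : 0 ≤ 1 - x := by linarith [hx.2]
  simp only [Complex.ofReal_mul]
  rw [Complex.ofReal_cpow hx.1.le, Complex.ofReal_cpow h1]
  push_cast
  rfl

theorem integral_rpow_mul_one_sub_sq {a s : ℝ} (ha : -1 < a) (hs : -1 < s) :
    ∫ t in Set.Ioo (0 : ℝ) 1, t ^ a * (1 - t ^ 2) ^ s =
      ProbabilityTheory.beta ((a + 1) / 2) (s + 1) / 2 := by
  have himg : (fun t : ℝ => t ^ 2) '' Set.Ioo 0 1 = Set.Ioo 0 1 := by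
    ext y
    constructor
    · rintro ⟨x, hx, rfl⟩
      exact ⟨pow_pos hx.1 2, pow_lt_one₀ hx.1.le hx.2 two_ne_zero⟩
    · intro hy
      refine ⟨√y, ⟨Real.sqrt_pos.2 hy.1, ?_⟩, Real.sq_sqrt hy.1.le⟩
      rw [Real.sqrt_lt' one_pos]
      simpa using hy.2
  have hinj : Set.InjOn (fun t : ℝ => t ^ 2) (Set.Ioo 0 1) := fun x hx y hy h =>
    (sq_eq_sq₀ hx.1.le hy.1.le).1 h
  have h := integral_image_eq_integral_abs_deriv_smul (f := fun t : ℝ => t ^ 2)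
    (f' := fun t => 2 * t) measurableSet_Ioo
    (fun x _ => by simpa using (hasDerivAt_pow 2 x).hasDerivWithinAt) hinj
    (fun x => x ^ ((a + 1) / 2 - 1) * (1 - x) ^ (s + 1 - 1))
  rw [himg, integral_beta (by linarith) (by linarith)] at h
  rw [h, eq_div_iff two_ne_zero, ← integral_mul_const]
  refine setIntegral_congr_fun measurableSet_Ioo fun x hx => ?_
  have hx0 : 0 < x := hx.1
  have e : (x ^ 2) ^ ((a + 1) / 2 - 1) * x = x ^ a := by
    rw [← Real.rpow_natCast x 2, ← Real.rpow_mul hx0.le]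
    nth_rewrite 2 [← Real.rpow_one x]
    rw [← Real.rpow_add hx0]
    congr 1
    push_cast
    ring
  simp only [smul_eq_mul]
  rw [abs_of_pos (by positivity), ← e, add_sub_cancel_right]
  ring

theorem intervalIntegrable_one_sub_sq_rpow {s : ℝ} (hs : -1 < s) :
    IntervalIntegrable (fun t : ℝ => (1 - t ^ 2) ^ s) volume (-1) 1 := by
  have h := integral_rpow_mul_one_sub_sq (a := 0) (by norm_num) hs
  have hpos : 0 < ProbabilityTheory.beta ((0 + 1) / 2) (s + 1) / 2 :=
    half_pos (ProbabilityTheory.beta_pos (by norm_num) (by linarith))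
  simp only [Real.rpow_zero, one_mul] at h
  have hi : IntegrableOn (fun t : ℝ => (1 - t ^ 2) ^ s) (Set.Ioo 0 1) := by
    by_contra hc
    rw [integral_undef hc] at h
    linarith
  have h01 : IntervalIntegrable (fun t : ℝ => (1 - t ^ 2) ^ s) volume 0 1 := by
    rw [intervalIntegrable_iff_integrableOn_Ioo_of_le zero_le_one]
    exact hi
  have h10 : IntervalIntegrable (fun t : ℝ => (1 - t ^ 2) ^ s) volume (-1) 0 := by
    rw [IntervalIntegrable.iff_comp_neg]
    simpa using h01.symm
  exact h10.trans h01

theorem intervalIntegrable_funkHecke {a s : ℝ} (ha : 0 < a) (hs : -1 < s) (k : ℕ)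
    {f : ℝ → ℝ} (hf : Continuous f) :
    IntervalIntegrable
      (fun t : ℝ => |t| ^ a * Real.sign t ^ k * f t * (1 - t ^ 2) ^ s) volume (-1) 1 := by
  obtain ⟨C, hC⟩ := (isCompact_Icc (a := (-1 : ℝ)) (b := 1)).exists_bound_of_continuousOn
    hf.continuousOn
  have hw := intervalIntegrable_one_sub_sq_rpow hs
  rw [intervalIntegrable_iff_integrableOn_Icc_of_le (by norm_num)] at hw ⊢
  have hsign : Measurable Real.sign :=
    Measurable.ite measurableSet_Iio measurable_const
      (Measurable.ite measurableSet_Ioi measurable_const measurable_const)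
  refine Integrable.bdd_mul (c := C) hw ?_ ?_
  · have hm : Measurable (fun t : ℝ => |t| ^ a * Real.sign t ^ k * f t) :=
      (((Real.continuous_rpow_const ha.le).measurable.comp continuous_abs.measurable).mul
        (hsign.pow_const k)).mul hf.measurable
    exact hm.aestronglyMeasurable
  · filter_upwards [ae_restrict_mem measurableSet_Icc] with t ht
    have h1 : |t| ^ a ≤ 1 := Real.rpow_le_one (abs_nonneg t) (abs_le.2 ht) ha.le
    have h2 : |Real.sign t| ^ k ≤ 1 := by
      refine pow_le_one₀ (abs_nonneg _) ?_
      rcases Real.sign_apply_eq t with h | h | h <;> simp [h]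
    have h3 := hC t ht
    have h0 : 0 ≤ |t| ^ a := by positivity
    rw [norm_mul, norm_mul, norm_pow, Real.norm_eq_abs (|t| ^ a), abs_of_nonneg h0,
      Real.norm_eq_abs (Real.sign t)]
    calc |t| ^ a * |Real.sign t| ^ k * ‖f t‖ ≤ 1 * ‖f t‖ := by
          gcongr
          exact mul_le_one₀ h1 (by positivity) h2
      _ ≤ C := by rwa [one_mul]

/-- The Funk–Hecke integral of `|t|^a (sgn t)^{χ_j}`, for a real Gegenbauer parameter. -/
def funkHeckeIntegral (b a : ℝ) (j : ℕ) : ℝ :=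
  ∫ t in (-1 : ℝ)..1,
    |t| ^ a * (Real.sign t) ^ (if Odd j then 1 else 0 : ℕ) *
      gegenbauerN b j t * (1 - t ^ 2) ^ (b - 1 / 2)

theorem abs_rpow_mul_sign_parity (a : ℝ) (ha : 0 < a) (t : ℝ) (j : ℕ) :
    |t| ^ a * (Real.sign t) ^ (if Odd (j + 1) then 1 else 0 : ℕ) * t =
      |t| ^ (a + 1) * (Real.sign t) ^ (if Odd j then 1 else 0 : ℕ) := by
  rcases eq_or_ne t 0 with rfl | ht
  · simp [Real.zero_rpow (by linarith : a + 1 ≠ 0)]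
  have habs : 0 < |t| := abs_pos.2 ht
  rw [Real.rpow_add habs, Real.rpow_one]
  rcases lt_or_gt_of_ne ht with h | h
  · by_cases hj : Odd j
    · simp [hj, Nat.odd_add_one, Real.sign_of_neg h, abs_of_neg h]
    · simp [hj, Nat.odd_add_one, Real.sign_of_neg h, abs_of_neg h]
  · by_cases hj : Odd j
    · simp [hj, Nat.odd_add_one, Real.sign_of_pos h, abs_of_pos h]
    · simp [hj, Nat.odd_add_one, Real.sign_of_pos h, abs_of_pos h]

theorem funkHeckeIntegral_zero {b a : ℝ} (hb : 0 ≤ b) (ha : 0 < a) :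
    funkHeckeIntegral b a 0 = ProbabilityTheory.beta ((a + 1) / 2) (b + 1 / 2) := by
  have hint := intervalIntegrable_funkHecke ha (s := b - 1 / 2) (by linarith) 0
    (continuous_const (y := (1 : ℝ)))
  have heq : funkHeckeIntegral b a 0 =
      ∫ t in (-1 : ℝ)..1, |t| ^ a * (1 - t ^ 2) ^ (b - 1 / 2) := by
    simp [funkHeckeIntegral, gegenbauerN_zero]
  simp only [pow_zero, mul_one] at hint
  have hsub1 : Set.uIcc (-1 : ℝ) 0 ⊆ Set.uIcc (-1) 1 := by
    rw [Set.uIcc_of_le (by norm_num), Set.uIcc_of_le (by norm_num)]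
    exact Set.Icc_subset_Icc_right zero_le_one
  have hsub2 : Set.uIcc (0 : ℝ) 1 ⊆ Set.uIcc (-1) 1 := by
    rw [Set.uIcc_of_le (by norm_num), Set.uIcc_of_le (by norm_num)]
    exact Set.Icc_subset_Icc_left (by norm_num)
  have hneg : ∫ t in (-1 : ℝ)..0, |t| ^ a * (1 - t ^ 2) ^ (b - 1 / 2) =
      ∫ t in (0 : ℝ)..1, |t| ^ a * (1 - t ^ 2) ^ (b - 1 / 2) := by
    have := intervalIntegral.integral_comp_neg (a := 0) (b := 1)
      (fun t : ℝ => |t| ^ a * (1 - t ^ 2) ^ (b - 1 / 2))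
    simpa using this.symm
  have hpos : ∫ t in (0 : ℝ)..1, |t| ^ a * (1 - t ^ 2) ^ (b - 1 / 2) =
      ProbabilityTheory.beta ((a + 1) / 2) (b + 1 / 2) / 2 := by
    have h := integral_rpow_mul_one_sub_sq (a := a) (s := b - 1 / 2) (by linarith) (by linarith)
    rw [show b - 1 / 2 + 1 = b + 1 / 2 by ring] at h
    rw [← h, intervalIntegral.integral_of_le zero_le_one, integral_Ioc_eq_integral_Ioo]
    refine setIntegral_congr_fun measurableSet_Ioo fun x hx => ?_
    simp only [abs_of_pos hx.1]
  rw [heq, ← intervalIntegral.integral_add_adjacent_intervals (hint.mono_set hsub1)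
    (hint.mono_set hsub2), hneg, hpos, add_halves]

theorem funkHeckeIntegral_one {b a : ℝ} (ha : 0 < a) :
    funkHeckeIntegral b a 1 = funkHeckeIntegral b (a + 1) 0 := by
  refine intervalIntegral.integral_congr fun t _ => ?_
  have h := abs_rpow_mul_sign_parity a ha t 0
  simp only [zero_add] at h
  simp only [gegenbauerN_zero, gegenbauerN_one, mul_one]
  rw [h]

theorem funkHeckeIntegral_recurrence {b a : ℝ} (hb : 0 ≤ b) (ha : 0 < a) (j : ℕ) :
    ((j : ℝ) + 1 + 2 * b) * funkHeckeIntegral b a (j + 2) =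
      2 * (j + 1 + b) * funkHeckeIntegral b (a + 1) (j + 1) -
        (j + 1) * funkHeckeIntegral b a j := by
  have hs : -1 < b - 1 / 2 := by linarith
  unfold funkHeckeIntegral
  rw [← intervalIntegral.integral_const_mul, ← intervalIntegral.integral_const_mul,
    ← intervalIntegral.integral_const_mul, ← intervalIntegral.integral_sub]
  · refine intervalIntegral.integral_congr fun t _ => ?_
    have h := abs_rpow_mul_sign_parity a ha t (j + 1)
    have hr := gegenbauerN_recurrence hb t j
    have hodd : Odd (j + 2) ↔ Odd j := by simp [Nat.odd_add_one]
    simp only [show j + 1 + 1 = j + 2 from rfl, hodd] at h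
    simp only [hodd]
    rw [← h]
    linear_combination (|t| ^ a * (Real.sign t) ^ (if Odd j then 1 else 0 : ℕ) *
      (1 - t ^ 2) ^ (b - 1 / 2)) * hr
  · exact (intervalIntegrable_funkHecke (by linarith) hs _
      (continuous_gegenbauerN b (j + 1))).const_mul _
  · exact (intervalIntegrable_funkHecke ha hs _ (continuous_gegenbauerN b j)).const_mul _

/-- The closed form `Γ(a+1) / (2^{a-1} Γ((j+a)/2+b+1) Γ((a-j)/2+1))`. -/
def funkHeckeCoeff (b a : ℝ) (j : ℕ) : ℝ :=
  Real.Gamma (a + 1) /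
    (2 ^ (a - 1) * Real.Gamma ((j + a) / 2 + b + 1) * Real.Gamma ((a - j) / 2 + 1))

/-- The functional equation of `1/Γ`, valid at every real point. -/
theorem inv_Gamma_eq_mul_inv_Gamma_add_one (x : ℝ) :
    (Real.Gamma x)⁻¹ = x * (Real.Gamma (x + 1))⁻¹ := by
  rcases eq_or_ne x 0 with rfl | hx
  · simp [Real.Gamma_zero]
  · rw [Real.Gamma_add_one hx, mul_inv, mul_inv_cancel_left₀ hx]

theorem funkHeckeCoeff_one {b a : ℝ} (ha : 0 < a) :
    funkHeckeCoeff b a 1 = funkHeckeCoeff b (a + 1) 0 := by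
  have h1 := inv_Gamma_eq_mul_inv_Gamma_add_one ((a + 1) / 2)
  simp only [funkHeckeCoeff, div_eq_mul_inv (Real.Gamma _), mul_inv, Nat.cast_one, Nat.cast_zero]
  rw [Real.Gamma_add_one (s := a + 1) (by positivity), show (a + 1 - 1) = (a - 1) + 1 by ring,
    Real.rpow_add_one two_ne_zero, mul_inv, show (a - 1) / 2 + 1 = (a + 1) / 2 by ring, h1,
    sub_zero, zero_add, add_comm 1 a]
  ring

theorem funkHeckeCoeff_recurrence {b a : ℝ} (ha : 0 < a) (j : ℕ) :
    ((j : ℝ) + 1 + 2 * b) * funkHeckeCoeff b a (j + 2) =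
      2 * (j + 1 + b) * funkHeckeCoeff b (a + 1) (j + 1) -
        (j + 1) * funkHeckeCoeff b a j := by
  have h1 := inv_Gamma_eq_mul_inv_Gamma_add_one ((a - j) / 2)
  have h2 := inv_Gamma_eq_mul_inv_Gamma_add_one ((j + a) / 2 + b + 1)
  simp only [funkHeckeCoeff, div_eq_mul_inv (Real.Gamma _), mul_inv, Nat.cast_add, Nat.cast_one,
    Nat.cast_ofNat]
  rw [Real.Gamma_add_one (s := a + 1) (by positivity), show (a + 1 - 1) = (a - 1) + 1 by ring,
    Real.rpow_add_one two_ne_zero, mul_inv,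
    show (a - (j + 2)) / 2 + 1 = (a - j) / 2 by ring,
    show (a + 1 - (j + 1)) / 2 + 1 = (a - j) / 2 + 1 by ring,
    show ((j : ℝ) + 2 + a) / 2 + b + 1 = (j + a) / 2 + b + 1 + 1 by ring,
    show ((j : ℝ) + 1 + (a + 1)) / 2 + b + 1 = (j + a) / 2 + b + 1 + 1 by ring, h1, h2]
  ring

theorem funkHeckeCoeff_zero {b a : ℝ} (hb : 0 ≤ b) (ha : 0 < a) :
    2 * ProbabilityTheory.beta ((a + 1) / 2) (b + 1 / 2) =
      √π * Real.Gamma (b + 1 / 2) * funkHeckeCoeff b a 0 := by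
  have h := Real.Gamma_mul_Gamma_add_half ((a + 1) / 2)
  rw [show (a + 1) / 2 + 1 / 2 = a / 2 + 1 by ring, show 2 * ((a + 1) / 2) = a + 1 by ring,
    show 1 - (a + 1) = -(a - 1) - 1 by ring, Real.rpow_sub_one two_ne_zero,
    Real.rpow_neg zero_le_two] at h
  have g1 : 0 < Real.Gamma (a / 2 + 1) := Real.Gamma_pos_of_pos (by positivity)
  have g2 : 0 < Real.Gamma (a / 2 + b + 1) := Real.Gamma_pos_of_pos (by positivity)
  have g3 : (0 : ℝ) < 2 ^ (a - 1) := by positivity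
  simp only [ProbabilityTheory.beta, funkHeckeCoeff, Nat.cast_zero, zero_add, sub_zero]
  rw [show (a + 1) / 2 + (b + 1 / 2) = a / 2 + b + 1 by ring]
  field_simp at h ⊢
  linear_combination h

theorem two_mul_funkHeckeIntegral {b : ℝ} (hb : 0 ≤ b) (j : ℕ) {a : ℝ} (ha : 0 < a) :
    2 * funkHeckeIntegral b a j = √π * Real.Gamma (b + 1 / 2) * funkHeckeCoeff b a j := by
  induction j using Nat.twoStepInduction generalizing a with
  | zero => rw [funkHeckeIntegral_zero hb ha, funkHeckeCoeff_zero hb ha]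
  | one =>
    rw [funkHeckeIntegral_one ha, funkHeckeCoeff_one ha,
      funkHeckeIntegral_zero hb (by linarith), funkHeckeCoeff_zero hb (by linarith)]
  | more j ih0 ih1 =>
    have hne : (j : ℝ) + 1 + 2 * b ≠ 0 := by positivity
    refine mul_left_cancel₀ hne ?_
    linear_combination 2 * funkHeckeIntegral_recurrence hb ha j -
      √π * Real.Gamma (b + 1 / 2) * funkHeckeCoeff_recurrence (b := b) ha j +
      2 * (j + 1 + b) * ih1 (a := a + 1) (by linarith) - (j + 1) * ih0 ha

/-- The Funk–Hecke integral: for `a > 0` and `j ∈ ℤ_+`,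
`A(S^{d-2}) ∫_{-1}^1 |t|^a (sgn t)^{χ_j} C̃_j^{(d-2)/2}(t) (1-t²)^{(d-3)/2} dt = w_j(a)`. -/
theorem stmt2 (d : ℕ) (hd : 2 ≤ d) (j : ℕ) (a : ℝ) (ha : 0 < a) :
    (2 * Real.pi ^ (((d : ℝ) - 1) / 2) / Real.Gamma (((d : ℝ) - 1) / 2)) *
      ∫ t in (-1 : ℝ)..1,
        |t| ^ a * (Real.sign t) ^ (if Odd j then 1 else 0 : ℕ) *
          gegenbauerN (((d : ℝ) - 2) / 2) j t * (1 - t ^ 2) ^ (((d : ℝ) - 3) / 2) =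
      w d a j := by
  have hd' : (2 : ℝ) ≤ d := by exact_mod_cast hd
  have hb : 0 ≤ ((d : ℝ) - 2) / 2 := by linarith
  have h := two_mul_funkHeckeIntegral hb j ha
  have hG : Real.Gamma (((d : ℝ) - 1) / 2) ≠ 0 :=
    (Real.Gamma_pos_of_pos (by linarith)).ne'
  have hpi : π ^ ((d : ℝ) / 2) = π ^ (((d : ℝ) - 1) / 2) * √π := by
    rw [Real.sqrt_eq_rpow, ← Real.rpow_add Real.pi_pos]
    congr 1
    ring
  unfold funkHeckeIntegral funkHeckeCoeff at h
  rw [show ((d : ℝ) - 2) / 2 + 1 / 2 = ((d : ℝ) - 1) / 2 by ring,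
    show ((d : ℝ) - 2) / 2 - 1 / 2 = ((d : ℝ) - 3) / 2 by ring,
    show ((j : ℝ) + a) / 2 + ((d : ℝ) - 2) / 2 + 1 = ((j : ℝ) + a + d) / 2 by ring] at h
  rw [w, hpi, div_mul_eq_mul_div, div_eq_iff hG]
  linear_combination π ^ (((d : ℝ) - 1) / 2) * h

end StablePaper
end
end

section
/- Let d ≥ 2, α ∈ (0,2) with α ≠ 1, and let μ be an α-stable distribution on ℝ^d with no shift whose spectral spherical measure is λ(dv) = P(v) ω(dv), where P is the restriction to S^{d−1} of a polynomial, P ≥ 0 and P not identically zero. Let V(u) = ∫_{S^{d−1}} |⟨u,v⟩|^α [1 − i tan(πα/2) sgn⟨u,v⟩] λ(dv). Then sup_{u ∈ S^{d−1}} |arg V(u)| < (π/2) min(α, 2−α), where arg denotes the principal argument. -/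
open MeasureTheory Real Filter Topology
open scoped RealInnerProductSpace ENNReal NNReal

noncomputable section

namespace StablePaper

theorem abs_arg_lt_of_abs_im_lt {z : ℂ} {θ : ℝ} (hθ0 : 0 < θ) (hθ : θ < π / 2) (hre : 0 < z.re)
    (him : |z.im| < Real.tan θ * z.re) : |z.arg| < θ := by
  have harg : |z.arg| < π / 2 := Complex.abs_arg_lt_pi_div_two_iff.2 (Or.inl hre)
  rw [abs_lt] at harg
  have hquot : |z.im / z.re| < Real.tan θ := by
    rwa [abs_div, abs_of_pos hre, div_lt_iff₀ hre]
  rw [abs_lt] at hquot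
  have key : Real.arctan (z.im / z.re) = z.arg := by
    rw [← Complex.tan_arg, Real.arctan_tan harg.1 harg.2]
  have hθ' : Real.arctan (Real.tan θ) = θ := Real.arctan_tan (by linarith) hθ
  rw [abs_lt, ← key, ← hθ', ← Real.arctan_neg]
  exact ⟨Real.arctan_strictMono hquot.1, Real.arctan_strictMono hquot.2⟩

theorem exists_pos_lt_pi_div_two_tan_eq_abs {α : ℝ} (hα0 : 0 < α) (hα2 : α < 2) (hα1 : α ≠ 1) :
    0 < π / 2 * min α (2 - α) ∧ π / 2 * min α (2 - α) < π / 2 ∧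
      Real.tan (π / 2 * min α (2 - α)) = |Real.tan (π * α / 2)| := by
  have hmin0 : 0 < min α (2 - α) := lt_min hα0 (by linarith)
  have hmin1 : min α (2 - α) < 1 := by
    rcases lt_or_gt_of_ne hα1 with h | h
    · exact min_lt_of_left_lt h
    · exact min_lt_of_right_lt (by linarith)
  have h0 : 0 < π / 2 * min α (2 - α) := by positivity
  have h1 : π / 2 * min α (2 - α) < π / 2 := by nlinarith [Real.pi_pos]
  refine ⟨h0, h1, ?_⟩
  have htan := Real.tan_pos_of_pos_of_lt_pi_div_two h0 h1
  rcases le_total α (2 - α) with h | h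
  · rw [min_eq_left h] at htan ⊢
    rw [show π * α / 2 = π / 2 * α by ring, abs_of_pos htan]
  · rw [min_eq_right h] at htan ⊢
    rw [show π * α / 2 = π - π / 2 * (2 - α) by ring, Real.tan_pi_sub, abs_neg, abs_of_pos htan]

theorem exists_unit_inner_eq_zero {d : ℕ} (hd : 2 ≤ d) (w : Ed d) :
    ∃ x : Ed d, ‖x‖ = 1 ∧ ⟪w, x⟫ = 0 := by
  have hfin : Module.finrank ℝ (Ed d) = d := by simp
  have hsum := Submodule.finrank_add_finrank_orthogonal (ℝ ∙ w)
  have hle : Module.finrank ℝ (ℝ ∙ w) ≤ 1 := by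
    simpa using finrank_span_le_card (R := ℝ) ({w} : Set (Ed d))
  have hne : (ℝ ∙ w)ᗮ ≠ ⊥ := fun h => by
    rw [h, finrank_bot] at hsum
    omega
  obtain ⟨y, hy, hy0⟩ := Submodule.exists_mem_ne_zero_of_ne_bot hne
  refine ⟨‖y‖⁻¹ • y, by simp [norm_smul, hy0], ?_⟩
  rw [inner_smul_right, Submodule.mem_orthogonal_singleton_iff_inner_right.1 hy, mul_zero]

theorem norm_cos_smul_add_sin_smul {d : ℕ} {w x : Ed d} (hw : ‖w‖ = 1) (hx : ‖x‖ = 1)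
    (hwx : ⟪w, x⟫ = 0) (t : ℝ) : ‖Real.cos t • w + Real.sin t • x‖ = 1 := by
  have h := norm_add_sq_eq_norm_sq_add_norm_sq_of_inner_eq_zero
    (Real.cos t • w) (Real.sin t • x) (by rw [inner_smul_left, inner_smul_right, hwx]; simp)
  rw [norm_smul, norm_smul, hw, hx] at h
  have h' : ‖Real.cos t • w + Real.sin t • x‖ * ‖Real.cos t • w + Real.sin t • x‖ = 1 := by
    rw [h]
    simp only [mul_one, Real.norm_eq_abs, abs_mul_abs_self]
    nlinarith [Real.sin_sq_add_cos_sq t]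
  nlinarith [norm_nonneg (Real.cos t • w + Real.sin t • x)]

/-- A polynomial vanishing on a relatively open arc of a great circle vanishes at its start. -/
theorem IsPolyRestriction.eq_zero_of_arc {d : ℕ} {P : Sph d → ℝ} (hP : IsPolyRestriction d P)
    {u : Ed d} (hu : ∀ v : Sph d, 0 < ⟪u, (v : Ed d)⟫ → P v = 0) (w : Sph d) {x : Ed d}
    (hx : ‖x‖ = 1) (hwx : ⟪(w : Ed d), x⟫ = 0) {t : ℝ}
    (ht : 0 < ⟪u, Real.cos t • (w : Ed d) + Real.sin t • x⟫) : P w = 0 := by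
  obtain ⟨p, hp⟩ := hP
  have hw : ‖(w : Ed d)‖ = 1 := norm_eq_of_mem_sphere w
  have hcont : Continuous fun s : ℝ => ⟪u, Real.cos s • (w : Ed d) + Real.sin s • x⟫ := by
    fun_prop
  have hana : AnalyticOnNhd ℝ (fun s : ℝ => MvPolynomial.aeval
      (fun i => Real.cos s * (w : Ed d) i + Real.sin s * x i) p) Set.univ := by
    refine fun s _ => AnalyticAt.aeval_mvPolynomial (fun i => ?_) p
    fun_prop
  have hev : (fun s : ℝ => MvPolynomial.aeval
      (fun i => Real.cos s * (w : Ed d) i + Real.sin s * x i) p) =ᶠ[𝓝 t] fun _ => (0 : ℝ) := by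
    filter_upwards [hcont.continuousAt.eventually (lt_mem_nhds ht)] with s hs
    have := hp ⟨_, mem_sphere_zero_iff_norm.2 (norm_cos_smul_add_sin_smul hw hx hwx s)⟩
    rw [hu _ hs] at this
    simpa [MvPolynomial.aeval_eq_eval] using this.symm
  have h0 := congrFun (hana.eq_of_eventuallyEq analyticOnNhd_const hev) 0
  rw [hp w]
  simpa [MvPolynomial.aeval_eq_eval] using h0

theorem IsPolyRestriction.exists_ne_zero_inner_pos {d : ℕ} (hd : 2 ≤ d) {P : Sph d → ℝ}
    (hP : IsPolyRestriction d P) (hPne : P ≠ 0) {u : Ed d} (hu0 : ‖u‖ = 1) :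
    ∃ v : Sph d, 0 < ⟪u, (v : Ed d)⟫ ∧ P v ≠ 0 := by
  by_contra! hu
  refine hPne (funext fun w => ?_)
  rcases lt_trichotomy ⟪u, (w : Ed d)⟫ 0 with h | h | h
  · obtain ⟨x, hx, hwx⟩ := exists_unit_inner_eq_zero hd (w : Ed d)
    exact hP.eq_zero_of_arc hu w hx hwx (t := π) (by simpa using h)
  · exact hP.eq_zero_of_arc hu w hu0 (by rw [real_inner_comm, h]) (t := π / 2)
      (by simp [hu0])
  · exact hu w h

theorem IsPolyRestriction.continuous {d : ℕ} {P : Sph d → ℝ} (hP : IsPolyRestriction d P) :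
    Continuous P := by
  obtain ⟨p, hp⟩ := hP
  rw [funext hp]
  exact (MvPolynomial.continuous_eval p).comp (by fun_prop)

instance (d : ℕ) : IsFiniteMeasure (ωd d) := by
  unfold ωd
  infer_instance

instance (d : ℕ) : (ωd d).IsOpenPosMeasure := by
  unfold ωd
  infer_instance

/-- The `α`-moment of the positive part of `⟨z, ·⟩` against the density `P`. -/
def halfMoment (d : ℕ) (α : ℝ) (P : Sph d → ℝ) (z : Ed d) : ℝ :=
  ∫ v, P v * (max ⟪z, (v : Ed d)⟫ 0) ^ α ∂(ωd d)

theorem continuous_posPart_rpow {α : ℝ} (hα0 : 0 < α) : Continuous fun t : ℝ => (max t 0) ^ α :=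
  (continuous_id.max continuous_const).rpow_const fun _ => Or.inr hα0.le

theorem continuous_halfMoment_integrand {d : ℕ} {α : ℝ} (hα0 : 0 < α) {P : Sph d → ℝ}
    (hP : Continuous P) (z : Ed d) :
    Continuous fun v : Sph d => P v * (max ⟪z, (v : Ed d)⟫ 0) ^ α :=
  hP.mul ((continuous_posPart_rpow hα0).comp (by fun_prop))

theorem continuous_halfMoment {d : ℕ} {α : ℝ} (hα0 : 0 < α) {P : Sph d → ℝ}
    (hP : Continuous P) : Continuous (halfMoment d α P) := by
  have hf : Continuous (Function.uncurry fun (z : Ed d) (v : Sph d) =>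
      P v * (max ⟪z, (v : Ed d)⟫ 0) ^ α) :=
    (hP.comp continuous_snd).mul ((continuous_posPart_rpow hα0).comp (by fun_prop))
  unfold halfMoment
  simpa only [Measure.restrict_univ] using
    continuous_parametric_integral_of_continuous (μ := ωd d) hf isCompact_univ

theorem halfMoment_pos {d : ℕ} (hd : 2 ≤ d) {α : ℝ} (hα0 : 0 < α) {P : Sph d → ℝ}
    (hpoly : IsPolyRestriction d P) (hP0 : ∀ u, 0 ≤ P u) (hPne : P ≠ 0) {u : Ed d}
    (hu : ‖u‖ = 1) : 0 < halfMoment d α P u := by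
  obtain ⟨v, hv, hPv⟩ := hpoly.exists_ne_zero_inner_pos hd hPne hu
  refine (continuous_halfMoment_integrand hα0 hpoly.continuous u
    ).integral_pos_of_hasCompactSupport_nonneg_nonzero (.of_compactSpace _)
    (fun x => mul_nonneg (hP0 x) (Real.rpow_nonneg (le_max_right _ _) _)) (x := v) ?_
  rw [max_eq_left hv.le]
  exact mul_ne_zero hPv (Real.rpow_pos_of_pos hv α).ne'

theorem abs_rpow_mul_one_sub_I_mul_sign {α : ℝ} (hα0 : 0 < α) (c t : ℝ) :
    ((|t| ^ α : ℝ) : ℂ) * (1 - Complex.I * (c : ℂ) * (Real.sign t : ℂ)) =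
      (((max t 0) ^ α : ℝ) : ℂ) * (1 - Complex.I * c) +
        (((max (-t) 0) ^ α : ℝ) : ℂ) * (1 + Complex.I * c) := by
  rcases lt_trichotomy t 0 with h | h | h
  · rw [abs_of_neg h, Real.sign_of_neg h, max_eq_right h.le, max_eq_left (by linarith),
      Real.zero_rpow hα0.ne']
    push_cast
    ring
  · simp [h, Real.zero_rpow hα0.ne']
  · rw [abs_of_pos h, Real.sign_of_pos h, max_eq_left h.le, max_eq_right (by linarith),
      Real.zero_rpow hα0.ne']
    push_cast
    ring

theorem charExp_specMeasure {d : ℕ} {α : ℝ} (hα0 : 0 < α) {P : Sph d → ℝ}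
    (hP : Continuous P) (hP0 : ∀ u, 0 ≤ P u) (z : Ed d) :
    charExp d α (specMeasure d P) z =
      (halfMoment d α P z : ℂ) * (1 - Complex.I * (Real.tan (π * α / 2) : ℂ)) +
        (halfMoment d α P (-z) : ℂ) * (1 + Complex.I * (Real.tan (π * α / 2) : ℂ)) := by
  have hint (z : Ed d) :
      Integrable (fun v : Sph d => ((P v * (max ⟪z, (v : Ed d)⟫ 0) ^ α : ℝ) : ℂ)) (ωd d) :=
    ((continuous_halfMoment_integrand hα0 hP z).integrable_of_hasCompactSupport
      (.of_compactSpace _)).ofReal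
  rw [charExp, specMeasure, integral_withDensity_eq_integral_toReal_smul
    hP.measurable.ennreal_ofReal (ae_of_all _ fun _ => ENNReal.ofReal_lt_top)]
  rw [halfMoment, halfMoment, ← integral_complex_ofReal, ← integral_complex_ofReal, ← integral_mul_const,
    ← integral_mul_const, ← integral_add ((hint z).mul_const _) ((hint (-z)).mul_const _)]
  refine integral_congr_ae (ae_of_all _ fun v => ?_)
  simp only [ENNReal.toReal_ofReal (hP0 v), Complex.real_smul, inner_neg_left]
  rw [abs_rpow_mul_one_sub_I_mul_sign hα0]
  push_cast
  ring

/-- Corollary: for a polynomial spectral spherical density `P ≠ 0` and `α ≠ 1`,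
`sup_{u} |arg V(u)| < (π/2) min(α, 2-α)`. -/
theorem stmt6 (d : ℕ) (hd : 2 ≤ d) (α : ℝ) (hα0 : 0 < α) (hα2 : α < 2) (hα1 : α ≠ 1)
    (P : Sph d → ℝ) (hpoly : IsPolyRestriction d P) (hP0 : ∀ u, 0 ≤ P u) (hPne : P ≠ 0)
    (μ : Measure (Ed d)) [IsProbabilityMeasure μ]
    (hμ : IsStableChar d α (specMeasure d P) μ) :
    (⨆ u : Sph d, |Complex.arg (Vfun d α (specMeasure d P) u)|) <
      Real.pi / 2 * min α (2 - α) := by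
  obtain ⟨hθ0, hθ1, htan⟩ := exists_pos_lt_pi_div_two_tan_eq_abs hα0 hα2 hα1
  have hc : 0 < |Real.tan (π * α / 2)| := htan ▸ Real.tan_pos_of_pos_of_lt_pi_div_two hθ0 hθ1
  have hV (u : Sph d) := charExp_specMeasure hα0 hpoly.continuous hP0 (u : Ed d)
  have hpos (u : Sph d) : 0 < halfMoment d α P u :=
    halfMoment_pos hd hα0 hpoly hP0 hPne (norm_eq_of_mem_sphere u)
  have hneg (u : Sph d) : 0 < halfMoment d α P (-(u : Ed d)) :=
    halfMoment_pos hd hα0 hpoly hP0 hPne (by rw [norm_neg, norm_eq_of_mem_sphere u])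
  have hre (u : Sph d) : (Vfun d α (specMeasure d P) u).re =
      halfMoment d α P u + halfMoment d α P (-(u : Ed d)) := by
    rw [Vfun, hV]
    generalize Real.tan (π * α / 2) = c
    simp
  have him (u : Sph d) : (Vfun d α (specMeasure d P) u).im =
      Real.tan (π * α / 2) * (halfMoment d α P (-(u : Ed d)) - halfMoment d α P u) := by
    rw [Vfun, hV]
    generalize Real.tan (π * α / 2) = c
    simp
    ring
  have hre_pos (u : Sph d) : 0 < (Vfun d α (specMeasure d P) u).re := by
    rw [hre]
    exact add_pos (hpos u) (hneg u)
  have hlt (u : Sph d) :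
      |Complex.arg (Vfun d α (specMeasure d P) u)| < π / 2 * min α (2 - α) := by
    refine abs_arg_lt_of_abs_im_lt hθ0 hθ1 (hre_pos u) ?_
    rw [htan, him, hre, abs_mul]
    refine mul_lt_mul_of_pos_left ?_ hc
    rw [abs_lt]
    constructor <;> linarith [hpos u, hneg u]
  have hVcont : Continuous (Vfun d α (specMeasure d P)) := by
    have hM := continuous_halfMoment hα0 hpoly.continuous
    unfold Vfun
    simp_rw [hV]
    fun_prop
  have hcont : Continuous fun u : Sph d => |Complex.arg (Vfun d α (specMeasure d P) u)| :=
    continuous_iff_continuousAt.2 fun u =>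
      ((Complex.continuousAt_arg (Or.inl (hre_pos u))).comp hVcont.continuousAt).abs
  obtain ⟨x, hx, -⟩ := exists_unit_inner_eq_zero hd (0 : Ed d)
  have : Nonempty (Sph d) := ⟨⟨x, mem_sphere_zero_iff_norm.2 hx⟩⟩
  obtain ⟨u, -, hu⟩ := isCompact_univ.exists_isMaxOn Set.univ_nonempty hcont.continuousOn
  exact (ciSup_le fun v => hu (Set.mem_univ v)).trans_lt (hlt u)

end StablePaper
end
end
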